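/- Let S_0 = 0, S_n = X_1 + … + X_n be a random walk with i.i.d. increments which is oscillating, i.e., limsup_n S_n = +∞ and liminf_n S_n = −∞ almost surely. Define v(x) := 1 + Σ_{k=1}^∞ P(−S_k > x, L_k ≥ 0) for x ≤ 0 (where L_k = min(S_1,…,S_k)), with v(0) = 1 and v(x) = 0 for x > 0. Then v satisfies the identity E[v(x + X); x + X < 0] = v(x) for all x ≤ 0, where X is distributed as X_1. -/

import Mathlib

open MeasureTheory ProbabilityTheory Filter Set Topology

noncomputable section

namespace BPREpaper

variable {Ω : Type*} [MeasurableSpace Ω]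

/-- The random walk `S n = X 1 + ... + X n` (increments indexed from `1`, `S 0 = 0`). -/
def walk (X : ℕ → Ω → ℝ) (n : ℕ) (ω : Ω) : ℝ := ∑ i ∈ Finset.Icc 1 n, X i ω

/-- `Mwalk X n = max (S 1, ..., S n)` for `n ≥ 1` (junk value `0` for `n = 0`). -/
def Mwalk (X : ℕ → Ω → ℝ) : ℕ → Ω → ℝ
  | 0, _ => 0
  | n + 1, ω =>
      (Finset.Icc 1 (n + 1)).sup' (Finset.nonempty_Icc.mpr (by omega)) fun i => walk X i ω

/-- `Lwalk X n = min (S 1, ..., S n)` for `n ≥ 1` (junk value `0` for `n = 0`). -/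
def Lwalk (X : ℕ → Ω → ℝ) : ℕ → Ω → ℝ
  | 0, _ => 0
  | n + 1, ω =>
      (Finset.Icc 1 (n + 1)).inf' (Finset.nonempty_Icc.mpr (by omega)) fun i => walk X i ω

/-- minimum of `S 0, S 1, ..., S n`. -/
def minWalk (X : ℕ → Ω → ℝ) (n : ℕ) (ω : Ω) : ℝ :=
  (Finset.range (n + 1)).inf' (by simp) fun i => walk X i ω

/-- `τ(n)`: the first moment at which the minimum of `S 0, ..., S n` is attained. -/
def tauWalk (X : ℕ → Ω → ℝ) (n : ℕ) (ω : Ω) : ℕ :=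
  sInf {i : ℕ | walk X i ω = minWalk X n ω}

/-- The renewal function `u(x) = 1 + ∑_{k ≥ 1} P(-S_k ≤ x, M_k < 0)` for `x ≥ 0`,
`u(x) = 0` for `x < 0`. -/
def uFun (μ : Measure Ω) (X : ℕ → Ω → ℝ) (x : ℝ) : ℝ :=
  if 0 ≤ x then
    1 + ∑' k : ℕ, (μ {ω | -walk X (k + 1) ω ≤ x ∧ Mwalk X (k + 1) ω < 0}).toReal
  else 0

/-- The renewal function `v(x) = 1 + ∑_{k ≥ 1} P(-S_k > x, L_k ≥ 0)` for `x ≤ 0`,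
`v(x) = 0` for `x > 0`. -/
def vFun (μ : Measure Ω) (X : ℕ → Ω → ℝ) (x : ℝ) : ℝ :=
  if x ≤ 0 then
    1 + ∑' k : ℕ, (μ {ω | x < -walk X (k + 1) ω ∧ 0 ≤ Lwalk X (k + 1) ω}).toReal
  else 0

/-- The event `{∀ 1 ≤ i ≤ n, x + S_i ≥ 0} = {L_n ≥ 0}` for the walk started at `x`. -/
def posSet (X : ℕ → Ω → ℝ) (x : ℝ) (n : ℕ) : Set Ω :=
  {ω | ∀ i ∈ Finset.Icc 1 n, 0 ≤ x + walk X i ω}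

/-- The event `{∀ 1 ≤ i ≤ n, x + S_i < 0} = {M_n < 0}` for the walk started at `x`. -/
def negSet (X : ℕ → Ω → ℝ) (x : ℝ) (n : ℕ) : Set Ω :=
  {ω | ∀ i ∈ Finset.Icc 1 n, x + walk X i ω < 0}

/-- A distribution on `ℝ` is non-lattice: it is not concentrated on any arithmetic
progression `a + hℤ`. -/
def NonLattice (ν : Measure ℝ) : Prop :=
  ¬ ∃ a h : ℝ, ν {x | ∃ k : ℤ, x = a + k * h} = 1

/-- `ν` is an `α`-stable law on `ℝ`. -/
def IsStableLaw (α : ℝ) (ν : Measure ℝ) : Prop :=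
  ∀ a b : ℝ, 0 < a → 0 < b → ∃ c d : ℝ, 0 < c ∧ a ^ α + b ^ α = c ^ α ∧
    ((ν.map (fun x => a * x)).prod (ν.map (fun x => b * x))).map (fun p : ℝ × ℝ => p.1 + p.2)
      = ν.map (fun x => c * x + d)

/-- Weak convergence of a sequence of laws on `ℝ`, tested against bounded continuous
functions. -/
def WeakTendsto (μs : ℕ → Measure ℝ) (ν : Measure ℝ) : Prop :=
  ∀ g : BoundedContinuousFunction ℝ ℝ,
    Tendsto (fun n => ∫ x, g x ∂(μs n)) atTop (𝓝 (∫ x, g x ∂ν))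

/-- Assumption A4: there are norming constants `c n → ∞` such that `S n / c n` converges in
distribution to an `α`-stable law concentrated neither on `[0,∞)` nor on `(-∞,0]`; the
increment distribution is non-lattice. -/
def AssumptionA4 (μ : Measure Ω) (X : ℕ → Ω → ℝ) (c : ℕ → ℝ) : Prop :=
  Tendsto c atTop atTop ∧ NonLattice (μ.map (X 1)) ∧
    ∃ (α : ℝ) (ν : Measure ℝ), IsProbabilityMeasure ν ∧ IsStableLaw α ν ∧
      0 < ν (Set.Iio 0) ∧ 0 < ν (Set.Ioi 0) ∧
      WeakTendsto (fun n => μ.map fun ω => walk X n ω / c n) ν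

/-- A family of random elements indexed by `ι` which is i.i.d. (the common distribution
being that of the element with index `i0`). -/
def IIDfam {ι : Type*} {E : Type*} [MeasurableSpace E] (μ : Measure Ω) (Q : ι → Ω → E)
    (i0 : ι) : Prop :=
  (∀ i, Measurable (Q i)) ∧ iIndepFun Q μ ∧
    ∀ i, IdentDistrib (Q i) (Q i0) μ μ

/-- An i.i.d. sequence indexed by `ℕ` (indices from `1` are the relevant ones). -/
def IIDseq {E : Type*} [MeasurableSpace E] (μ : Measure Ω) (Q : ℕ → Ω → E) : Prop :=
  IIDfam μ Q 1

/-- `P` is the h-transform measure `P_x⁺`: for every `n` and every bounded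
`F n`-measurable `g`, `E_P[g] = u(x)⁻¹ E_x[g · u(S_n); L_n ≥ 0]`. -/
def IsPplus (μ : Measure Ω) (X : ℕ → Ω → ℝ) (F : ℕ → MeasurableSpace Ω) (x : ℝ)
    (P : Measure Ω) : Prop :=
  IsProbabilityMeasure P ∧
    ∀ (n : ℕ) (g : Ω → ℝ), Measurable[F n] g → (∃ C, ∀ ω, |g ω| ≤ C) →
      ∫ ω, g ω ∂P =
        (uFun μ X x)⁻¹ * ∫ ω in posSet X x n, g ω * uFun μ X (x + walk X n ω) ∂μ

/-- `P` is the h-transform measure `P_x⁻`: for every `n` and every bounded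
`F n`-measurable `g`, `E_P[g] = v(x)⁻¹ E_x[g · v(S_n); M_n < 0]`. -/
def IsPminus (μ : Measure Ω) (X : ℕ → Ω → ℝ) (F : ℕ → MeasurableSpace Ω) (x : ℝ)
    (P : Measure Ω) : Prop :=
  IsProbabilityMeasure P ∧
    ∀ (n : ℕ) (g : Ω → ℝ), Measurable[F n] g → (∃ C, ∀ ω, |g ω| ≤ C) →
      ∫ ω, g ω ∂P =
        (vFun μ X x)⁻¹ * ∫ ω in negSet X x n, g ω * vFun μ X (x + walk X n ω) ∂μ

/-- The filtration generated by the environment `Q 1, ..., Q n`. -/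
def envFiltration {E : Type*} [MeasurableSpace E] (Q : ℕ → Ω → E) (n : ℕ) :
    MeasurableSpace Ω :=
  ⨆ i ∈ Finset.Icc 1 n, MeasurableSpace.comap (Q i) inferInstance

/-- The σ-algebra generated by the whole environment `Q 1, Q 2, ...`. -/
def envSigma {E : Type*} [MeasurableSpace E] (Q : ℕ → Ω → E) : MeasurableSpace Ω :=
  ⨆ i, MeasurableSpace.comap (Q (i + 1)) inferInstance




/-- Probability generating function of the (random) offspring law `Q n`. -/
def pgf (Q : ℕ → Ω → Measure ℕ) (n : ℕ) (ω : Ω) (s : ℝ) : ℝ :=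
  ∑' i : ℕ, (Q n ω {i}).toReal * s ^ i

/-- Mean `m(Q_n)` of the offspring law `Q n`. -/
def meanQ (Q : ℕ → Ω → Measure ℕ) (n : ℕ) (ω : Ω) : ℝ :=
  ∑' i : ℕ, (i : ℝ) * (Q n ω {i}).toReal

/-- `X_n = log f_n'(1)`, the increments of the associated random walk. -/
def Xenv (Q : ℕ → Ω → Measure ℕ) (n : ℕ) (ω : Ω) : ℝ := Real.log (meanQ Q n ω)

/-- `η_n = f_n''(1) / (2 f_n'(1)^2)`. -/
def etaEnv (Q : ℕ → Ω → Measure ℕ) (n : ℕ) (ω : Ω) : ℝ :=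
  (∑' i : ℕ, ((i : ℝ) * ((i : ℝ) - 1)) * (Q n ω {i}).toReal) / (2 * meanQ Q n ω ^ 2)

/-- The associated random walk `S_n = X_1 + ... + X_n`. -/
def Senv (Q : ℕ → Ω → Measure ℕ) : ℕ → Ω → ℝ := walk (Xenv Q)

/-- The composition `f_{j,n}(s) = f_{j+1}(f_{j+2}(⋯ f_n(s) ⋯))`, with `f_{j,n} = id` for
`n ≤ j`. -/
def pgfComp (Q : ℕ → Ω → Measure ℕ) (j : ℕ) : ℕ → Ω → ℝ → ℝ
  | 0, _, s => s
  | n + 1, ω, s => if n + 1 ≤ j then s else pgfComp Q j n ω (pgf Q (n + 1) ω s)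

/-- `b_n = ∑_{i=0}^{n-1} η_{i+1} e^{-S_i}`. -/
def bEnv (Q : ℕ → Ω → Measure ℕ) (n : ℕ) (ω : Ω) : ℝ :=
  ∑ i ∈ Finset.range n, etaEnv Q (i + 1) ω * Real.exp (-(Senv Q i ω))

/-- `B⁺ = ∑_{i=0}^∞ η_{i+1} e^{-S_i}`. -/
def Bplus (Q : ℕ → Ω → Measure ℕ) (ω : Ω) : ℝ :=
  ∑' i : ℕ, etaEnv Q (i + 1) ω * Real.exp (-(Senv Q i ω))

/-- `B⁻ = ∑_{i=1}^∞ η_i e^{S_i}`. -/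
def Bminus (Q : ℕ → Ω → Measure ℕ) (ω : Ω) : ℝ :=
  ∑' i : ℕ, etaEnv Q (i + 1) ω * Real.exp (Senv Q (i + 1) ω)

/-- `V_∞(r) = 1 / (B⁻ + (1 - r)⁻¹)`. -/
def Vinf (Q : ℕ → Ω → Measure ℕ) (r : ℝ) (ω : Ω) : ℝ := (Bminus Q ω + (1 - r)⁻¹)⁻¹

/-- All the offspring generating functions are fractional linear:
`1/(1 - f_n(s)) = e^{-X_n}/(1-s) + η_n`. -/
def FracLinear (Q : ℕ → Ω → Measure ℕ) : Prop :=
  ∀ n, 1 ≤ n → ∀ ω : Ω, ∀ s : ℝ, 0 ≤ s → s < 1 →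
    (1 - pgf Q n ω s)⁻¹ = Real.exp (-(Xenv Q n ω)) / (1 - s) + etaEnv Q n ω

/-- Assumption A1 with explicit constant `χ`. -/
def AssumptionA1With (μ : Measure Ω) (Q : ℕ → Ω → Measure ℕ) (χ : ℝ) : Prop :=
  0 < χ ∧ χ < 1 / 2 ∧ ∀ n, 1 ≤ n →
    ∀ᵐ ω ∂μ, χ ≤ pgf Q n ω 0 ∧ pgf Q n ω 0 ≤ 1 - χ ∧ χ ≤ etaEnv Q n ω

/-- Assumption A1: for some `χ ∈ (0,1/2)`, `χ ≤ f(0) ≤ 1 - χ` and `η ≥ χ` a.s. -/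
def AssumptionA1 (μ : Measure Ω) (Q : ℕ → Ω → Measure ℕ) : Prop :=
  ∃ χ : ℝ, AssumptionA1With μ Q χ

/-- Assumption A2: `X` has zero mean, finite positive variance and is non-lattice. -/
def AssumptionA2 (μ : Measure Ω) (Q : ℕ → Ω → Measure ℕ) : Prop :=
  Integrable (Xenv Q 1) μ ∧ (∫ ω, Xenv Q 1 ω ∂μ) = 0 ∧
    Integrable (fun ω => Xenv Q 1 ω ^ 2) μ ∧ 0 < ∫ ω, Xenv Q 1 ω ^ 2 ∂μ ∧
    NonLattice (μ.map (Xenv Q 1))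

/-- `ζ(a) = ∑_{y ≥ a} y² Q({y}) / m(Q)²`. -/
def zetaEnv (Q : ℕ → Ω → Measure ℕ) (a : ℕ) (ω : Ω) : ℝ :=
  (∑' y : ℕ, if a ≤ y then (y : ℝ) ^ 2 * (Q 1 ω {y}).toReal else 0) / meanQ Q 1 ω ^ 2

/-- Assumption A3: `E[(log⁺ ζ(a))^{2+ε}] < ∞` for some `ε > 0`, `a ∈ ℕ`. -/
def AssumptionA3 (μ : Measure Ω) (Q : ℕ → Ω → Measure ℕ) : Prop :=
  ∃ ε : ℝ, 0 < ε ∧ ∃ a : ℕ, 1 ≤ a ∧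
    Integrable (fun ω => Real.log (max (zetaEnv Q a ω) 1) ^ (2 + ε)) μ

/-- The extinction moment `T = min {k ≥ 0 : Z_k = 0}`. -/
def extinctTime (Z : ℕ → Ω → ℕ) (ω : Ω) : ℕ := sInf {k | Z k ω = 0}

/-- The branching property of `Z` in the environment `Q` (started from one particle):
given the environment and `Z_k`, the conditional generating function of `Z_n` is
`f_{k,n}(s)^{Z_k}`; the state `0` is absorbing. -/
def BranchingProperty (μ : Measure Ω) (Q : ℕ → Ω → Measure ℕ) (Z : ℕ → Ω → ℕ) : Prop :=
  (∀ ω, Z 0 ω = 1) ∧ (∀ n, Measurable (Z n)) ∧ (∀ n ω, Z n ω = 0 → Z (n + 1) ω = 0) ∧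
    ∀ k n : ℕ, k ≤ n → ∀ s : ℝ, 0 ≤ s → s ≤ 1 →
      (μ[fun ω => s ^ Z n ω | envSigma Q ⊔ MeasurableSpace.comap (Z k) inferInstance])
        =ᵐ[μ] fun ω => pgfComp Q k n ω s ^ Z k ω



lemma measurable_walk {X : ℕ → Ω → ℝ} (hX : ∀ i, Measurable (X i)) (n : ℕ) :
    Measurable (walk X n) := by
  unfold walk
  fun_prop

lemma walk_succ {Ω : Type*} (X : ℕ → Ω → ℝ) (n : ℕ) (ω : Ω) :
    walk X (n + 1) ω = walk X n ω + X (n + 1) ω := by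
  simp [walk, Finset.sum_Icc_succ_top]

lemma measurableSet_posSet {X : ℕ → Ω → ℝ} (hX : ∀ i, Measurable (X i)) (x : ℝ) (n : ℕ) :
    MeasurableSet (posSet X x n) := by
  have : posSet X x n = ⋂ i ∈ Finset.Icc 1 n, {ω | 0 ≤ x + walk X i ω} := by
    ext ω; simp [posSet]
  rw [this]
  exact Finset.measurableSet_biInter _ fun i _ =>
    measurableSet_le measurable_const ((measurable_walk hX i).const_add x)

lemma mem_posSet_succ {Ω : Type*} {X : ℕ → Ω → ℝ} {x : ℝ} {n : ℕ} {ω : Ω} :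
    ω ∈ posSet X x (n + 1) ↔ ω ∈ posSet X x n ∧ 0 ≤ x + walk X (n + 1) ω := by
  simp only [posSet, Set.mem_ofPred_eq, Finset.mem_Icc]
  refine ⟨fun h => ⟨fun i hi => h i ⟨hi.1, by omega⟩, h _ ⟨by omega, le_rfl⟩⟩, ?_⟩
  rintro ⟨h, h'⟩ i ⟨hi, hi'⟩
  rcases Nat.lt_or_ge n i with hni | hni
  · obtain rfl : i = n + 1 := by omega
    exact h'
  · exact h i ⟨hi, hni⟩

lemma Lwalk_nonneg_iff {Ω : Type*} (X : ℕ → Ω → ℝ) (n : ℕ) (ω : Ω) :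
    0 ≤ Lwalk X (n + 1) ω ↔ ω ∈ posSet X 0 (n + 1) := by
  simp [Lwalk, posSet, Finset.le_inf'_iff]

/-- The past increments are independent of the next one. -/
lemma indepFun_past {μ : Measure Ω} {X : ℕ → Ω → ℝ}
    (hX : ∀ i, Measurable (X i)) (hind : iIndepFun X μ) (k : ℕ) :
    IndepFun (fun ω (j : ℕ) => if j ≤ k then X j ω else 0) (X (k + 1)) μ := by
  have h := hind.indepFun_finset (Finset.range (k + 1)) {k + 1} (by simp) hX
  have hφ : Measurable fun (t : Finset.range (k + 1) → ℝ) (j : ℕ) =>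
      if hj : j ≤ k then t ⟨j, by simpa [Nat.lt_succ_iff] using hj⟩ else 0 := by
    refine measurable_pi_lambda _ fun j => ?_
    by_cases hj : j ≤ k
    · simp only [hj, dite_true]; fun_prop
    · simp only [hj, dite_false]; fun_prop
  have hψ : Measurable fun (t : ({k + 1} : Finset ℕ) → ℝ) => t ⟨k + 1, by simp⟩ := by
    fun_prop
  exact h.comp hφ hψ

/-- The mass that the walk killed on entering `(-∞, 0)` puts on `(-∞, y)` at time `k`. -/
def killedMass (μ : Measure Ω) (X : ℕ → Ω → ℝ) (k : ℕ) (y : ℝ) : ENNReal :=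
  μ (posSet X 0 k ∩ {ω | walk X k ω < y})

/-- The Green function of the killed walk on `(-∞, y)`. -/
def killedGreen (μ : Measure Ω) (X : ℕ → Ω → ℝ) (y : ℝ) : ENNReal :=
  ∑' k, killedMass μ X k y

lemma killedMass_mono (μ : Measure Ω) (X : ℕ → Ω → ℝ) (k : ℕ) :
    Monotone (killedMass μ X k) := fun _ _ h =>
  measure_mono <| Set.inter_subset_inter_right _ fun _ hω => lt_of_lt_of_le hω h

lemma killedGreen_mono (μ : Measure Ω) (X : ℕ → Ω → ℝ) : Monotone (killedGreen μ X) :=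
  fun _ _ h => ENNReal.tsum_le_tsum fun k => killedMass_mono μ X k h

lemma killedMass_of_nonpos (μ : Measure Ω) (X : ℕ → Ω → ℝ) (k : ℕ) {y : ℝ} (hy : y ≤ 0) :
    killedMass μ X k y = 0 := by
  unfold killedMass
  convert measure_empty (μ := μ)
  ext ω
  simp only [Set.mem_inter_iff, Set.mem_ofPred_eq, Set.mem_empty_iff_false, iff_false, not_and,
    not_lt]
  intro h
  rcases k with _ | k
  · simpa [walk] using hy
  · have := (mem_posSet_succ.1 h).2
    linarith

lemma killedGreen_of_nonpos (μ : Measure Ω) (X : ℕ → Ω → ℝ) {y : ℝ} (hy : y ≤ 0) :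
    killedGreen μ X y = 0 := by
  simp [killedGreen, killedMass_of_nonpos μ X _ hy]

lemma killedMass_zero (μ : Measure Ω) [IsProbabilityMeasure μ] (X : ℕ → Ω → ℝ) {y : ℝ}
    (hy : 0 < y) : killedMass μ X 0 y = 1 := by
  simp [killedMass, posSet, walk, hy]

lemma killedGreen_of_pos (μ : Measure Ω) [IsProbabilityMeasure μ] (X : ℕ → Ω → ℝ) {y : ℝ}
    (hy : 0 < y) : killedGreen μ X y = 1 + ∑' k, killedMass μ X (k + 1) y := by
  rw [killedGreen, tsum_eq_zero_add' ENNReal.summable, killedMass_zero μ X hy]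

/-- One step of the killed walk, before killing. -/
lemma measure_posSet_walk_succ_lt {μ : Measure Ω} [IsProbabilityMeasure μ] {X : ℕ → Ω → ℝ}
    (hiid : IIDseq μ X) (k : ℕ) (y : ℝ) :
    μ (posSet X 0 k ∩ {ω | walk X (k + 1) ω < y}) =
      ∫⁻ ω, killedMass μ X k (y - X 1 ω) ∂μ := by
  obtain ⟨hX, hind, hid⟩ := hiid
  let Y : Ω → ℕ → ℝ := fun ω j => if j ≤ k then X j ω else 0
  have hY : Measurable Y := measurable_pi_lambda _ fun j => by
    by_cases hj : j ≤ k <;> simp only [Y, hj, if_true, if_false] <;> fun_prop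
  let e : ℕ → (ℕ → ℝ) → ℝ := fun i t => t i
  have he : ∀ i, Measurable (e i) := fun i => measurable_pi_apply i
  have hwalk : ∀ ω, ∀ i ≤ k, walk e i (Y ω) = walk X i ω := by
    intro ω i hi
    refine Finset.sum_congr rfl fun j hj => ?_
    have : j ≤ k := (Finset.mem_Icc.1 hj).2.trans hi
    simp [e, Y, this]
  have hpos : ∀ ω, Y ω ∈ posSet e 0 k ↔ ω ∈ posSet X 0 k := by
    intro ω
    simp only [posSet, Set.mem_ofPred_eq]
    refine forall₂_congr fun i hi => ?_
    rw [hwalk ω i (Finset.mem_Icc.1 hi).2]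
  let C : Set ((ℕ → ℝ) × ℝ) := {p | p.1 ∈ posSet e 0 k ∧ walk e k p.1 + p.2 < y}
  have hC : MeasurableSet C :=
    (measurable_fst (measurableSet_posSet he 0 k)).inter
      (measurableSet_lt (((measurable_walk he k).comp measurable_fst).add measurable_snd)
        measurable_const)
  have hprod := (indepFun_iff_map_prod_eq_prod_map_map hY.aemeasurable
    (hX (k + 1)).aemeasurable).1 (indepFun_past hX hind k)
  have := Measure.isProbabilityMeasure_map (μ := μ) hY.aemeasurable
  have := Measure.isProbabilityMeasure_map (μ := μ) (hX (k + 1)).aemeasurable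
  calc μ (posSet X 0 k ∩ {ω | walk X (k + 1) ω < y})
      = μ.map (fun ω => (Y ω, X (k + 1) ω)) C := by
        rw [Measure.map_apply (hY.prodMk (hX _)) hC]
        congr 1
        ext ω
        simp [C, hpos, hwalk, walk_succ]
    _ = ∫⁻ x, μ.map Y ((fun t => (t, x)) ⁻¹' C) ∂(μ.map (X (k + 1))) := by
        rw [hprod, Measure.prod_apply_symm hC]
    _ = ∫⁻ x, killedMass μ X k (y - x) ∂(μ.map (X (k + 1))) := by
        refine lintegral_congr fun x => ?_
        rw [Measure.map_apply hY (measurable_prodMk_right hC), killedMass]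
        congr 1
        ext ω
        simp [C, hpos, hwalk, lt_sub_iff_add_lt]
    _ = ∫⁻ ω, killedMass μ X k (y - X 1 ω) ∂μ := by
        rw [(hid (k + 1)).map_eq, lintegral_map _ (hX 1)]
        exact (killedMass_mono μ X k).measurable.comp (measurable_const.sub measurable_id)

lemma measure_posSet_walk_succ_lt_eq_add {μ : Measure Ω} {X : ℕ → Ω → ℝ}
    (hX : ∀ i, Measurable (X i)) (k : ℕ) {y : ℝ} (hy : 0 ≤ y) :
    μ (posSet X 0 k ∩ {ω | walk X (k + 1) ω < y}) =
      killedMass μ X (k + 1) y + μ (posSet X 0 k \ posSet X 0 (k + 1)) := by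
  rw [killedMass, ← measure_union _
    ((measurableSet_posSet hX 0 k).diff (measurableSet_posSet hX 0 (k + 1)))]
  · congr 1
    ext ω
    simp only [Set.mem_inter_iff, Set.mem_ofPred_eq, Set.mem_union, Set.mem_sdiff,
      mem_posSet_succ, zero_add]
    by_cases h : 0 ≤ walk X (k + 1) ω
    · simp [h]
    · have : walk X (k + 1) ω < y := (not_le.1 h).trans_le hy
      simp [h, this]
  · rw [Set.disjoint_left]
    exact fun ω h h' => h'.2 h.1

/-- A walk that takes negative values enters `(-∞, 0)` for a first time. -/
lemma tsum_measure_posSet_diff {μ : Measure Ω} [IsProbabilityMeasure μ] {X : ℕ → Ω → ℝ}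
    (hX : ∀ i, Measurable (X i)) (hneg : ∀ᵐ ω ∂μ, ∃ n, walk X n ω < 0) :
    ∑' k, μ (posSet X 0 k \ posSet X 0 (k + 1)) = 1 := by
  have hanti : Antitone (posSet X 0) :=
    antitone_nat_of_succ_le fun n ω h => (mem_posSet_succ.1 h).1
  rw [← measure_iUnion]
  · rw [← measure_univ (μ := μ)]
    refine measure_congr ?_
    rw [ae_eq_univ]
    refine measure_mono_null (fun ω hω => ?_) hneg
    simp only [Set.mem_compl_iff, Set.mem_iUnion, Set.mem_sdiff, not_exists, not_and,
      not_not] at hω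
    have hall : ∀ n, ω ∈ posSet X 0 n := fun n => by
      induction n with
      | zero => simp [posSet]
      | succ n ih => exact hω n ih
    rintro ⟨n, hn⟩
    rcases n with _ | n
    · simp [walk] at hn
    · have := (mem_posSet_succ.1 (hall (n + 1))).2
      linarith
  · intro i j hij
    rw [Function.onFun, Set.disjoint_left]
    rintro ω ⟨hi, hi'⟩ ⟨hj, hj'⟩
    rcases lt_or_gt_of_ne hij with h | h
    · exact hi' (hanti h hj)
    · exact hj' (hanti h hi)
  · exact fun k => (measurableSet_posSet hX 0 k).diff (measurableSet_posSet hX 0 (k + 1))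

/-- The harmonicity identity for the Green function, with values in `[0, ∞]`. -/
lemma lintegral_killedGreen {μ : Measure Ω} [IsProbabilityMeasure μ] {X : ℕ → Ω → ℝ}
    (hiid : IIDseq μ X) (hneg : ∀ᵐ ω ∂μ, ∃ n, walk X n ω < 0) {y : ℝ} (hy : 0 ≤ y) :
    ∫⁻ ω, killedGreen μ X (y - X 1 ω) ∂μ = 1 + ∑' k, killedMass μ X (k + 1) y := by
  have hX := hiid.1
  have hmeas : ∀ k, AEMeasurable (fun ω => killedMass μ X k (y - X 1 ω)) μ := fun k =>
    ((killedMass_mono μ X k).measurable.comp (measurable_const.sub (hX 1))).aemeasurable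
  unfold killedGreen
  rw [lintegral_tsum hmeas]
  simp_rw [← measure_posSet_walk_succ_lt hiid, measure_posSet_walk_succ_lt_eq_add hX _ hy]
  rw [ENNReal.tsum_add, tsum_measure_posSet_diff hX hneg, add_comm]

lemma exists_measure_lt_neg_ne_zero {μ : Measure Ω} [IsProbabilityMeasure μ] {X : ℕ → Ω → ℝ}
    (hiid : IIDseq μ X) (hneg : ∀ᵐ ω ∂μ, ∃ n, walk X n ω < 0) :
    ∃ ε > 0, μ {ω | X 1 ω < -ε} ≠ 0 := by
  obtain ⟨hX, -, hid⟩ := hiid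
  by_contra! h
  have h1 : ∀ᵐ ω ∂μ, ∀ n : ℕ, -(1 / ((n : ℝ) + 1)) ≤ X 1 ω := by
    rw [ae_all_iff]
    intro n
    have := h (1 / ((n : ℝ) + 1)) (by positivity)
    rw [ae_iff]
    simpa using this
  have h2 : ∀ᵐ ω ∂μ, 0 ≤ X 1 ω := by
    filter_upwards [h1] with ω hω
    by_contra! hlt
    obtain ⟨n, hn⟩ := exists_nat_one_div_lt (neg_pos.2 hlt)
    linarith [hω n]
  have h3 : ∀ᵐ ω ∂μ, ∀ i, 0 ≤ X i ω := ae_all_iff.2 fun i =>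
    ((hid i).symm.ae_snd (p := fun x => 0 ≤ x) measurableSet_Ici h2)
  obtain ⟨ω, hω, n, hn⟩ := (h3.and hneg).exists
  exact hn.not_ge (Finset.sum_nonneg fun i _ => hω i)

lemma killedGreen_ne_top {μ : Measure Ω} [IsProbabilityMeasure μ] {X : ℕ → Ω → ℝ}
    (hiid : IIDseq μ X) (hneg : ∀ᵐ ω ∂μ, ∃ n, walk X n ω < 0) (y : ℝ) :
    killedGreen μ X y ≠ ⊤ := by
  obtain ⟨ε, hε, hp⟩ := exists_measure_lt_neg_ne_zero hiid hneg
  have hX := hiid.1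
  have hstep : ∀ z : ℝ, 0 ≤ z →
      killedGreen μ X (z + ε) * μ {ω | X 1 ω < -ε} ≤ 1 + killedGreen μ X z := by
    intro z hz
    have hS : MeasurableSet {ω | X 1 ω < -ε} := measurableSet_lt (hX 1) measurable_const
    calc killedGreen μ X (z + ε) * μ {ω | X 1 ω < -ε}
        = ∫⁻ _ in {ω | X 1 ω < -ε}, killedGreen μ X (z + ε) ∂μ := by simp
      _ ≤ ∫⁻ ω in {ω | X 1 ω < -ε}, killedGreen μ X (z - X 1 ω) ∂μ :=
          setLIntegral_mono' hS fun ω hω => killedGreen_mono μ X (by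
            have : X 1 ω < -ε := hω
            linarith)
      _ ≤ ∫⁻ ω, killedGreen μ X (z - X 1 ω) ∂μ := setLIntegral_le_lintegral _ _
      _ = 1 + ∑' k, killedMass μ X (k + 1) z := lintegral_killedGreen hiid hneg hz
      _ ≤ 1 + killedGreen μ X z := by
          gcongr
          exact ENNReal.tsum_comp_le_tsum_of_injective (add_left_injective 1) _
  have hn : ∀ n : ℕ, killedGreen μ X (n * ε) ≠ ⊤ := by
    intro n
    induction n with
    | zero => simp [killedGreen_of_nonpos μ X le_rfl]
    | succ n ih =>
      intro htop
      have h := hstep (n * ε) (by positivity)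
      have he : (n : ℝ) * ε + ε = ((n + 1 : ℕ) : ℝ) * ε := by push_cast; ring
      rw [he, htop, ENNReal.top_mul hp, top_le_iff] at h
      exact ENNReal.add_ne_top.2 ⟨ENNReal.one_ne_top, ih⟩ h
  obtain ⟨n, hn'⟩ := exists_nat_ge (y / ε)
  exact ne_top_of_le_ne_top (hn n) (killedGreen_mono μ X ((div_le_iff₀ hε).1 hn'))

lemma vFun_eq_toReal {μ : Measure Ω} [IsProbabilityMeasure μ] {X : ℕ → Ω → ℝ}
    (hfin : ∀ y, killedGreen μ X y ≠ ⊤) {x : ℝ} (hx : x ≤ 0) :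
    vFun μ X x = (1 + ∑' k, killedMass μ X (k + 1) (-x)).toReal := by
  have hsum : ∑' k, killedMass μ X (k + 1) (-x) ≠ ⊤ :=
    ne_top_of_le_ne_top (hfin (-x))
      (ENNReal.tsum_comp_le_tsum_of_injective (add_left_injective 1) _)
  rw [vFun, if_pos hx, ENNReal.toReal_add ENNReal.one_ne_top hsum, ENNReal.toReal_one,
    ENNReal.tsum_toReal_eq fun k => ENNReal.ne_top_of_tsum_ne_top hsum k]
  congr 2
  funext k
  rw [killedMass]
  congr 2
  ext ω
  simp only [Set.mem_ofPred_eq, Set.mem_inter_iff, Lwalk_nonneg_iff, lt_neg (a := x)]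
  exact and_comm

/-- **Harmonicity of `v`.** For an oscillating random walk with i.i.d. increments,
the function `v(x) = 1 + ∑_{k≥1} P(-S_k > x, L_k ≥ 0)` satisfies
`E[v(x + X); x + X < 0] = v(x)` for all `x ≤ 0`. -/
theorem statement5
    {Ω : Type*} [MeasurableSpace Ω] (μ : Measure Ω) [IsProbabilityMeasure μ]
    (X : ℕ → Ω → ℝ) (hiid : IIDseq μ X)
    (hosc : ∀ᵐ ω ∂μ, (∀ C : ℝ, ∃ n, C < walk X n ω) ∧ (∀ C : ℝ, ∃ n, walk X n ω < C)) :
    ∀ x : ℝ, x ≤ 0 →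
      ∫ ω in {ω | x + X 1 ω < 0}, vFun μ X (x + X 1 ω) ∂μ = vFun μ X x := by
  intro x hx
  have hneg : ∀ᵐ ω ∂μ, ∃ n, walk X n ω < 0 := hosc.mono fun ω h => h.2 0
  have hfin := killedGreen_ne_top hiid hneg
  have hX := hiid.1
  have hS : MeasurableSet {ω | x + X 1 ω < 0} :=
    measurableSet_lt ((hX 1).const_add x) measurable_const
  have hmeas : Measurable fun ω => killedGreen μ X (-x - X 1 ω) :=
    (killedGreen_mono μ X).measurable.comp (measurable_const.sub (hX 1))
  rw [vFun_eq_toReal hfin hx, ← lintegral_killedGreen hiid hneg (neg_nonneg.2 hx),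
    ← integral_toReal hmeas.aemeasurable (ae_of_all _ fun ω => (hfin _).lt_top),
    ← integral_indicator hS]
  congr 1
  funext ω
  by_cases hω : x + X 1 ω < 0
  · rw [Set.indicator_of_mem (s := {ω | x + X 1 ω < 0}) hω, vFun_eq_toReal hfin hω.le,
      ← killedGreen_of_pos μ X (neg_pos.2 hω), neg_add']
  · rw [Set.indicator_of_notMem (s := {ω | x + X 1 ω < 0}) hω,
      killedGreen_of_nonpos μ X (by linarith), ENNReal.toReal_zero]

end BPREpaper
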